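/- For every real β ≥ 1, every real C > 0, every integer N ≥ 1 and every positive integer m, with h = h_w(β) = log(e^{4β}/(e^{4β}−1)) and H_w = ⌊(6β)^{−1} log N⌋, one has P_N^{β,h_w}( {φ ∈ Ω_N : |φ^{−1}(0)| ≤ C N^{4/3}} ∩ {φ ∈ Ω_N : |{x ∈ Λ_N : 1 ≤ φ(x) ≤ H_w − m}| ≥ 2 e^{−2βm} N²} ) ≤ 2 exp( 4βN + 4βC N^{4/3} − (1/2) e^{2βm} N^{4/3} ). -/

import Mathlib

open Real Finset
open scoped Classical

noncomputable section

/-- The box `Λ_N = {1,…,N}²` in `ℤ²`. -/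
def Lam (N : ℕ) : Finset (ℤ × ℤ) := Finset.Icc (1:ℤ) (N:ℤ) ×ˢ Finset.Icc (1:ℤ) (N:ℤ)

/-- The four nearest neighbors of a site of `ℤ²`. -/
def nbrs (x : ℤ × ℤ) : Finset (ℤ × ℤ) :=
  {(x.1 + 1, x.2), (x.1 - 1, x.2), (x.1, x.2 + 1), (x.1, x.2 - 1)}

/-- An enlarged box containing all edges touching `Λ_N`. -/
def Box (N : ℕ) : Finset (ℤ × ℤ) := Finset.Icc (0:ℤ) ((N:ℤ)+1) ×ˢ Finset.Icc (0:ℤ) ((N:ℤ)+1)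

/-- The SOS Hamiltonian with zero boundary conditions, for fields vanishing outside `Λ_N`:
each edge `{x,y}` with `x ~ y` touching `Λ_N` is counted twice in the double sum (once from
each endpoint, both endpoints lying in `Box N`), whence the factor `1/2`.  Since the field
vanishes outside `Λ_N`, this equals
`Σ_{{x,y}⊂Λ_N, x~y} |φ(x)−φ(y)| + Σ_{x∈Λ_N, y∉Λ_N, x~y} |φ(x)|`. -/
def Ham (N : ℕ) (φ : ℤ × ℤ → ℤ) : ℝ :=
  (1/2) * ∑ x ∈ Box N, ∑ y ∈ nbrs x, |(φ x : ℝ) - (φ y : ℝ)|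

/-- The level set `φ⁻¹(k)` inside `Λ_N`. -/
def levelSet (N : ℕ) (φ : ℤ × ℤ → ℤ) (k : ℤ) : Finset (ℤ × ℤ) :=
  (Lam N).filter fun x => φ x = k

/-- The configuration space `Ω_N`: nonnegative integer fields vanishing outside `Λ_N`. -/
def Conf (N : ℕ) : Type :=
  {φ : ℤ × ℤ → ℤ // (∀ x, 0 ≤ φ x) ∧ ∀ x ∉ Lam N, φ x = 0}

/-- The Boltzmann weight `exp(−β H_N(φ) + h |φ⁻¹(0)|)`. -/
def weight (N : ℕ) (β h : ℝ) (φ : ℤ × ℤ → ℤ) : ℝ :=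
  Real.exp (-β * Ham N φ + h * ((levelSet N φ 0).card : ℝ))

/-- The partition function `Z_N^{β,h}`. -/
def Z (N : ℕ) (β h : ℝ) : ℝ := ∑' φ : Conf N, weight N β h φ.val

/-- The probability of an event `E ⊆ Ω_N` under `P_N^{β,h}`. -/
def prob (N : ℕ) (β h : ℝ) (E : Set (Conf N)) : ℝ :=
  (∑' φ : Conf N, if φ ∈ E then weight N β h φ.val else 0) / Z N β h

/-- The critical pinning value `h_w(β) = log(e^{4β}/(e^{4β}−1))`. -/
def hw (β : ℝ) : ℝ := Real.log (Real.exp (4*β) / (Real.exp (4*β) - 1))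

lemma sum_nbrs (x : ℤ × ℤ) (f : ℤ × ℤ → ℝ) :
    ∑ y ∈ nbrs x, f y =
      f (x.1 + 1, x.2) + f (x.1 - 1, x.2) + f (x.1, x.2 + 1) + f (x.1, x.2 - 1) := by
  unfold nbrs
  rw [sum_insert, sum_insert, sum_insert, sum_singleton]
  · ring
  all_goals
    simp only [mem_insert, mem_singleton, Prod.mk.injEq]
    omega

lemma sum_comp_ite_le {α : Type*} [DecidableEq α] (A B : Finset α) (f : α → ℝ) (hf : ∀ x, 0 ≤ f x)
    (g : α → α) (hg : Function.Injective g) :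
    ∑ x ∈ B, (if g x ∈ A then f (g x) else 0) ≤ ∑ x ∈ A, f x := by
  rw [← sum_filter, ← sum_image (f := f) (g := g) (fun _ _ _ _ h => hg h)]
  refine sum_le_sum_of_subset_of_nonneg ?_ fun x _ _ => hf x
  intro y hy
  obtain ⟨x, hx, rfl⟩ := mem_image.1 hy
  exact (mem_filter.1 hx).2

/-- The field `φ` set to zero on `A`. -/
def zeroOn (A : Finset (ℤ × ℤ)) (φ : ℤ × ℤ → ℤ) : ℤ × ℤ → ℤ := fun x => if x ∈ A then 0 else φ x

/-- Setting a nonnegative field to zero on `A` costs at most four times the sum of its heights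
there. -/
lemma Ham_zeroOn_le (N : ℕ) (A : Finset (ℤ × ℤ)) (φ : ℤ × ℤ → ℤ) (hφ : ∀ x, 0 ≤ φ x) :
    Ham N (zeroOn A φ) ≤ Ham N φ + 4 * ∑ x ∈ A, (φ x : ℝ) := by
  have hφ' : ∀ x, (0 : ℝ) ≤ φ x := fun x => by exact_mod_cast hφ x
  set d : ℤ × ℤ → ℝ := fun x => if x ∈ A then (φ x : ℝ) else 0 with hd
  have hedge : ∀ x y, |((zeroOn A φ x : ℤ) : ℝ) - (zeroOn A φ y : ℤ)| ≤
      |(φ x : ℝ) - φ y| + (d x + d y) := by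
    intro x y
    have hx : ((zeroOn A φ x : ℤ) : ℝ) = φ x - d x := by
      simp only [zeroOn, hd]; split_ifs <;> simp
    have hy : ((zeroOn A φ y : ℤ) : ℝ) = φ y - d y := by
      simp only [zeroOn, hd]; split_ifs <;> simp
    have hdx : 0 ≤ d x := by simp only [hd]; split_ifs <;> simp [hφ']
    have hdy : 0 ≤ d y := by simp only [hd]; split_ifs <;> simp [hφ']
    rw [hx, hy, abs_le]
    constructor <;> cases abs_cases ((φ x : ℝ) - φ y) <;> linarith
  have hdsum : ∀ g : ℤ × ℤ → ℤ × ℤ, Function.Injective g →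
      ∑ x ∈ Box N, d (g x) ≤ ∑ x ∈ A, (φ x : ℝ) :=
    fun g hg => sum_comp_ite_le A (Box N) (fun x => (φ x : ℝ)) hφ' g hg
  have h0 := hdsum id Function.injective_id
  have h1 := hdsum (fun x => (x.1 + 1, x.2)) (fun a b h => by
    simp only [Prod.mk.injEq] at h; ext <;> omega)
  have h2 := hdsum (fun x => (x.1 - 1, x.2)) (fun a b h => by
    simp only [Prod.mk.injEq] at h; ext <;> omega)
  have h3 := hdsum (fun x => (x.1, x.2 + 1)) (fun a b h => by
    simp only [Prod.mk.injEq] at h; ext <;> omega)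
  have h4 := hdsum (fun x => (x.1, x.2 - 1)) (fun a b h => by
    simp only [Prod.mk.injEq] at h; ext <;> omega)
  have hsum : ∑ x ∈ Box N, ∑ y ∈ nbrs x, |((zeroOn A φ x : ℤ) : ℝ) - (zeroOn A φ y : ℤ)| ≤
      ∑ x ∈ Box N, (∑ y ∈ nbrs x, |(φ x : ℝ) - φ y| + ∑ y ∈ nbrs x, (d x + d y)) := by
    refine sum_le_sum fun x _ => ?_
    rw [← sum_add_distrib]
    exact sum_le_sum fun y _ => hedge x y
  simp only [id] at h0
  have hd8 : ∑ x ∈ Box N, ∑ y ∈ nbrs x, (d x + d y) ≤ 8 * ∑ x ∈ A, (φ x : ℝ) := by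
    simp only [sum_nbrs, sum_add_distrib]
    linarith
  rw [sum_add_distrib] at hsum
  unfold Ham
  linarith

lemma levelSet_zeroOn (N : ℕ) (A : Finset (ℤ × ℤ)) (hA : A ⊆ Lam N) (φ : ℤ × ℤ → ℤ) :
    levelSet N (zeroOn A φ) 0 = levelSet N φ 0 ∪ A := by
  ext x
  simp only [levelSet, zeroOn, mem_filter, mem_union]
  by_cases hx : x ∈ A
  · simp [hx, hA hx]
  · simp [hx]

lemma exp_hw {β : ℝ} (hβ : 0 < β) : exp (hw β) = (1 - exp (-4 * β))⁻¹ := by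
  have h1 : 1 < exp (4 * β) := one_lt_exp_iff.2 (by linarith)
  have h2 : exp (-4 * β) = (exp (4 * β))⁻¹ := by rw [← exp_neg]; ring_nf
  have h3 : exp (4 * β) - 1 ≠ 0 := by linarith
  rw [hw, exp_log (div_pos (by linarith) (by linarith)), h2]
  field_simp

/-- Lower bound on the weight after pinning the heights of `A` to zero. -/
lemma weight_zeroOn_ge (N : ℕ) {β : ℝ} (hβ : 0 < β) (A : Finset (ℤ × ℤ)) (hA : A ⊆ Lam N)
    (φ : ℤ × ℤ → ℤ) (hφ : ∀ x, 0 ≤ φ x) (hpos : ∀ x ∈ A, φ x ≠ 0) :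
    weight N β (hw β) φ *
        ∏ x ∈ A, (exp (-4 * β) ^ (φ x).toNat * (1 - exp (-4 * β))⁻¹) ≤
      weight N β (hw β) (zeroOn A φ) := by
  have hprod : ∏ x ∈ A, (exp (-4 * β) ^ (φ x).toNat * (1 - exp (-4 * β))⁻¹) =
      exp (-4 * β * ∑ x ∈ A, (φ x : ℝ) + hw β * A.card) := by
    rw [prod_mul_distrib, prod_const, ← exp_hw hβ, exp_add, ← exp_nat_mul, mul_sum, exp_sum,
      mul_comm (hw β)]
    congr 1
    refine prod_congr rfl fun x _ => ?_
    rw [← exp_nat_mul]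
    have : (((φ x).toNat : ℤ) : ℝ) = φ x := by rw [Int.toNat_of_nonneg (hφ x)]
    rw [← this]
    push_cast
    ring_nf
  have hdisj : Disjoint (levelSet N φ 0) A := by
    rw [Finset.disjoint_left]
    intro x hx hxA
    exact hpos x hxA (mem_filter.1 hx).2
  rw [hprod, weight, weight, ← exp_add, levelSet_zeroOn N A hA, card_union_of_disjoint hdisj]
  refine exp_le_exp.2 ?_
  have := mul_le_mul_of_nonneg_left (Ham_zeroOn_le N A φ hφ) hβ.le
  push_cast
  linarith

/-- A subprobability distribution on the heights `k` below a site of height `a`: a site of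
positive height is kept, and a zero is lifted to a height at most `K`. -/
def liftProb (r : ℝ) (K a k : ℤ) : ℝ :=
  if a = 0 then
    (if k = 0 then r else if 1 ≤ k ∧ k ≤ K then (1 - r) ^ 2 * r ^ (K - k).toNat else 0)
  else if k = a then 1 else 0

lemma liftProb_nonneg {r : ℝ} (hr : 0 ≤ r) (K a k : ℤ) : 0 ≤ liftProb r K a k := by
  unfold liftProb
  split_ifs <;> positivity

lemma sum_liftProb_le {r : ℝ} (hr : 0 ≤ r) (hr1 : r < 1) (K a : ℤ) (T : Finset ℤ) :
    ∑ k ∈ T, liftProb r K a k ≤ 1 := by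
  by_cases ha : a = 0
  · have hle : ∀ k, liftProb r K a k ≤ (if k = 0 then r else 0) +
        (if k ∈ Finset.Icc 1 K then (1 - r) ^ 2 * r ^ (K - k).toNat else 0) := by
      intro k
      have : 0 ≤ (1 - r) ^ 2 * r ^ (K - k).toNat := by positivity
      simp only [liftProb, ha, if_true, Finset.mem_Icc]
      split_ifs <;> linarith
    have h1 : ∑ k ∈ T, (if k = 0 then r else 0) ≤ r := by
      rw [sum_ite_eq']
      split_ifs <;> linarith
    have h2 : ∑ k ∈ T, (if k ∈ Finset.Icc 1 K then (1 - r) ^ 2 * r ^ (K - k).toNat else 0) ≤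
        ∑ k ∈ Finset.Icc 1 K, (1 - r) ^ 2 * r ^ (K - k).toNat :=
      sum_comp_ite_le (Finset.Icc 1 K) T (fun k => (1 - r) ^ 2 * r ^ (K - k).toNat)
        (fun k => by positivity) id Function.injective_id
    have h3 : ∑ k ∈ Finset.Icc 1 K, (1 - r) ^ 2 * r ^ (K - k).toNat ≤
        ∑ j ∈ Finset.range K.toNat, (1 - r) ^ 2 * r ^ j := by
      rw [← sum_image (f := fun j => (1 - r) ^ 2 * r ^ j) (g := fun k : ℤ => (K - k).toNat)]
      · refine sum_le_sum_of_subset_of_nonneg ?_ fun j _ _ => by positivity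
        intro j hj
        obtain ⟨k, hk, rfl⟩ := Finset.mem_image.1 hj
        simp only [Finset.mem_Icc, Finset.mem_range] at hk ⊢
        omega
      · intro k hk l hl h
        simp only [Finset.coe_Icc, Set.mem_Icc] at hk hl h
        omega
    have h4 : ∑ j ∈ Finset.range K.toNat, (1 - r) ^ 2 * r ^ j ≤ 1 - r := by
      rw [← mul_sum]
      have hg := geom_sum_mul r K.toNat
      have hp : 0 ≤ r ^ K.toNat := by positivity
      have : (1 - r) ^ 2 * ∑ j ∈ Finset.range K.toNat, r ^ j =
          (1 - r) * (1 - r ^ K.toNat) := by linear_combination (-(1 - r)) * hg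
      rw [this]
      nlinarith
    calc ∑ k ∈ T, liftProb r K a k ≤ _ := sum_le_sum fun k _ => hle k
      _ ≤ 1 := by rw [sum_add_distrib]; linarith
  · simp only [liftProb, ha, if_false]
    rw [sum_ite_eq']
    split_ifs <;> norm_num

/-- The weight of the configuration `φ` among those lifted from `ψ`. -/
def liftKernel (N : ℕ) (r : ℝ) (K : ℤ) (φ ψ : ℤ × ℤ → ℤ) : ℝ :=
  ∏ x ∈ Lam N, liftProb r K (ψ x) (φ x)

lemma liftKernel_nonneg (N : ℕ) {r : ℝ} (hr : 0 ≤ r) (K : ℤ) (φ ψ : ℤ × ℤ → ℤ) :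
    0 ≤ liftKernel N r K φ ψ :=
  prod_nonneg fun _ _ => liftProb_nonneg hr _ _ _

lemma sum_liftKernel_le (N : ℕ) {r : ℝ} (hr : 0 ≤ r) (hr1 : r < 1) (K : ℤ) (ψ : ℤ × ℤ → ℤ)
    (T : Finset (Conf N)) : ∑ φ ∈ T, liftKernel N r K φ.val ψ ≤ 1 := by
  set t : Lam N → Finset ℤ := fun x => T.image fun φ => φ.val x
  set g : Conf N → Lam N → ℤ := fun φ x => φ.val x
  have hg : Function.Injective g := by
    intro φ φ' h
    refine Subtype.ext (funext fun x => ?_)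
    by_cases hx : x ∈ Lam N
    · exact congrFun h ⟨x, hx⟩
    · rw [φ.2.2 x hx, φ'.2.2 x hx]
  calc ∑ φ ∈ T, liftKernel N r K φ.val ψ
      = ∑ φ ∈ T, ∏ x : Lam N, liftProb r K (ψ x) (g φ x) := by
        refine sum_congr rfl fun φ _ => ?_
        rw [liftKernel, ← prod_coe_sort]
    _ = ∑ p ∈ T.image g, ∏ x : Lam N, liftProb r K (ψ x) (p x) :=
        (sum_image (f := fun p : Lam N → ℤ => ∏ x : Lam N, liftProb r K (ψ x) (p x))
          fun _ _ _ _ h => hg h).symm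
    _ ≤ ∑ p ∈ Fintype.piFinset t, ∏ x : Lam N, liftProb r K (ψ x) (p x) := by
        refine sum_le_sum_of_subset_of_nonneg ?_
          fun p _ _ => prod_nonneg fun _ _ => liftProb_nonneg hr _ _ _
        intro p hp
        obtain ⟨φ, hφ, rfl⟩ := Finset.mem_image.1 hp
        exact Fintype.mem_piFinset.2 fun x => Finset.mem_image_of_mem _ hφ
    _ = ∏ x : Lam N, ∑ k ∈ t x, liftProb r K (ψ x) k :=
        (prod_univ_sum t fun x k => liftProb r K (ψ x) k).symm
    _ ≤ 1 := prod_le_one (fun x _ => sum_nonneg fun k _ => liftProb_nonneg hr _ _ _)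
        fun x _ => sum_liftProb_le hr hr1 _ _ _

/-- The sites of `Λ_N` with height between `1` and `K`. -/
def lowSites (N : ℕ) (φ : ℤ × ℤ → ℤ) (K : ℤ) : Finset (ℤ × ℤ) :=
  (Lam N).filter fun x => 1 ≤ φ x ∧ φ x ≤ K

/-- A configuration set to zero on `A`. -/
def Conf.zeroOn {N : ℕ} (A : Finset (ℤ × ℤ)) (φ : Conf N) : Conf N :=
  ⟨_root_.zeroOn A φ.val, fun x => by
    have := φ.2.1 x
    simp only [_root_.zeroOn]
    split_ifs <;> omega, fun x hx => by simp [_root_.zeroOn, φ.2.2 x hx]⟩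

lemma liftKernel_zeroOn (N : ℕ) (r : ℝ) (K : ℤ) (φ : ℤ × ℤ → ℤ) (A : Finset (ℤ × ℤ))
    (hA : A ⊆ lowSites N φ K) :
    liftKernel N r K φ (zeroOn A φ) =
      r ^ (levelSet N φ 0).card * ∏ x ∈ A, ((1 - r) ^ 2 * r ^ (K - φ x).toNat) := by
  have hAL : A ⊆ Lam N := hA.trans (filter_subset _ _)
  have hlow : ∀ x ∈ A, 1 ≤ φ x ∧ φ x ≤ K := fun x hx => (mem_filter.1 (hA hx)).2
  have hpt : ∀ x ∈ Lam N, liftProb r K (zeroOn A φ x) (φ x) =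
      (if φ x = 0 then r else 1) *
        (if x ∈ A then (1 - r) ^ 2 * r ^ (K - φ x).toNat else 1) := by
    intro x _
    by_cases hx : x ∈ A
    · have h := hlow x hx
      have h0 : φ x ≠ 0 := by omega
      simp [liftProb, zeroOn, hx, h, h0]
    · by_cases h0 : φ x = 0 <;> simp [liftProb, zeroOn, hx, h0]
  rw [liftKernel, prod_congr rfl hpt, prod_mul_distrib, ← prod_filter, ← prod_filter,
    prod_const, filter_mem_eq_inter, inter_eq_right.2 hAL]
  rfl

/-- Summing over the subsets of low sites that are pinned to zero. -/
lemma weight_mul_le_sum_powerset {N : ℕ} {β : ℝ} (hβ : 0 < β) (K : ℕ) (φ : Conf N) :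
    weight N β (hw β) φ.val * (exp (-4 * β) ^ (levelSet N φ.val 0).card *
        (1 + (1 - exp (-4 * β)) * exp (-4 * β) ^ K) ^ (lowSites N φ.val K).card) ≤
      ∑ A ∈ (lowSites N φ.val K).powerset,
        liftKernel N (exp (-4 * β)) K φ.val (φ.zeroOn A).val *
          weight N β (hw β) (φ.zeroOn A).val := by
  set r := exp (-4 * β) with hr
  have hr0 : 0 < r := exp_pos _
  have hr1 : r < 1 := Real.exp_lt_one_iff.2 (by linarith)
  rw [add_comm 1, ← sum_pow_mul_eq_add_pow, mul_sum, mul_sum]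
  refine sum_le_sum fun A hA => ?_
  rw [mem_powerset] at hA
  have hlow : ∀ x ∈ A, 1 ≤ φ.val x ∧ φ.val x ≤ K := fun x hx => (mem_filter.1 (hA hx)).2
  have hw' := weight_zeroOn_ge N hβ A (hA.trans (filter_subset _ _)) φ.val φ.2.1
    (fun x hx => by have := hlow x hx; omega)
  rw [← hr] at hw'
  have hk := liftKernel_zeroOn N r K φ.val A hA
  have hprod : (∏ x ∈ A, ((1 - r) ^ 2 * r ^ ((K : ℤ) - φ.val x).toNat)) *
      ∏ x ∈ A, (r ^ (φ.val x).toNat * (1 - r)⁻¹) = ((1 - r) * r ^ K) ^ A.card := by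
    rw [← prod_mul_distrib, ← prod_const]
    refine prod_congr rfl fun x hx => ?_
    have h := hlow x hx
    have hK : K = ((K : ℤ) - φ.val x).toNat + (φ.val x).toNat := by omega
    have h1 : 1 - r ≠ 0 := by linarith
    conv_rhs => rw [hK, pow_add]
    field_simp
  calc weight N β (hw β) φ.val * (r ^ (levelSet N φ.val 0).card *
        (((1 - r) * r ^ K) ^ A.card * 1 ^ ((lowSites N φ.val K).card - A.card)))
      = liftKernel N r K φ.val (zeroOn A φ.val) * (weight N β (hw β) φ.val *
          ∏ x ∈ A, (r ^ (φ.val x).toNat * (1 - r)⁻¹)) := by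
        rw [hk, ← hprod]
        ring
    _ ≤ _ := mul_le_mul_of_nonneg_left hw' (liftKernel_nonneg N hr0.le _ _ _)

lemma zeroOn_injOn {N : ℕ} (K : ℤ) (φ : Conf N) :
    Set.InjOn (fun A => φ.zeroOn A) ((lowSites N φ.val K).powerset : Set (Finset (ℤ × ℤ))) := by
  intro A hA B hB h
  have hA' := mem_powerset.1 (mem_coe.1 hA)
  have hB' := mem_powerset.1 (mem_coe.1 hB)
  ext x
  have hx : zeroOn A φ.val x = zeroOn B φ.val x := congrFun (congrArg Subtype.val h) x
  have hlA : x ∈ A → 1 ≤ φ.val x := fun hx => (mem_filter.1 (hA' hx)).2.1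
  have hlB : x ∈ B → 1 ≤ φ.val x := fun hx => (mem_filter.1 (hB' hx)).2.1
  simp only [zeroOn] at hx
  by_cases h1 : x ∈ A <;> by_cases h2 : x ∈ B
  · exact iff_of_true h1 h2
  · rw [if_pos h1, if_neg h2] at hx
    have := hlA h1
    omega
  · rw [if_neg h1, if_pos h2] at hx
    have := hlB h2
    omega
  · exact iff_of_false h1 h2

lemma weight_pos (N : ℕ) (β h : ℝ) (φ : ℤ × ℤ → ℤ) : 0 < weight N β h φ := exp_pos _

/-- The mass of a finite set of configurations, tilted by the gain in entropy from pinning low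
sites to zero, is at most the partition function. -/
lemma sum_weight_mul_le_Z {N : ℕ} {β : ℝ} (hβ : 0 < β) (K : ℕ)
    (hs : Summable fun φ : Conf N => weight N β (hw β) φ.val) (T : Finset (Conf N)) :
    ∑ φ ∈ T, weight N β (hw β) φ.val * (exp (-4 * β) ^ (levelSet N φ.val 0).card *
        (1 + (1 - exp (-4 * β)) * exp (-4 * β) ^ K) ^ (lowSites N φ.val K).card) ≤
      Z N β (hw β) := by
  have hr0 : 0 ≤ exp (-4 * β) := (exp_pos _).le
  have hr1 : exp (-4 * β) < 1 := Real.exp_lt_one_iff.2 (by linarith)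
  have hw0 : ∀ φ : Conf N, 0 ≤ weight N β (hw β) φ.val := fun φ => (weight_pos N _ _ _).le
  set U : Finset (Conf N) :=
    T.biUnion fun φ => (lowSites N φ.val K).powerset.image fun A => φ.zeroOn A
  calc _ ≤ ∑ φ ∈ T, ∑ A ∈ (lowSites N φ.val K).powerset,
        liftKernel N (exp (-4 * β)) K φ.val (φ.zeroOn A).val *
          weight N β (hw β) (φ.zeroOn A).val :=
        sum_le_sum fun φ _ => weight_mul_le_sum_powerset hβ K φ
    _ ≤ ∑ φ ∈ T, ∑ ψ ∈ U,
        liftKernel N (exp (-4 * β)) K φ.val ψ.val * weight N β (hw β) ψ.val := by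
        refine sum_le_sum fun φ hφ => ?_
        rw [← sum_image (f := fun ψ : Conf N =>
          liftKernel N (exp (-4 * β)) K φ.val ψ.val * weight N β (hw β) ψ.val)
          (zeroOn_injOn K φ)]
        exact sum_le_sum_of_subset_of_nonneg (subset_biUnion_of_mem
          (fun φ : Conf N => (lowSites N φ.val K).powerset.image fun A => φ.zeroOn A) hφ)
          fun ψ _ _ => mul_nonneg (liftKernel_nonneg N hr0 _ _ _) (hw0 ψ)
    _ = ∑ ψ ∈ U, (∑ φ ∈ T, liftKernel N (exp (-4 * β)) K φ.val ψ.val) *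
          weight N β (hw β) ψ.val := by
        rw [sum_comm]
        exact sum_congr rfl fun ψ _ => (sum_mul _ _ _).symm
    _ ≤ ∑ ψ ∈ U, weight N β (hw β) ψ.val :=
        sum_le_sum fun ψ _ => mul_le_of_le_one_left (hw0 ψ)
          (sum_liftKernel_le N hr0 hr1 K ψ.val T)
    _ ≤ Z N β (hw β) := hs.sum_le_tsum U fun ψ _ => hw0 ψ

/-- A uniform entropy gain on an event bounds its probability. -/
lemma prob_le_of_entropy_gain {N : ℕ} {β : ℝ} (hβ : 0 < β) (K : ℕ) (E : Set (Conf N)) {R : ℝ}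
    (hR : 0 ≤ R)
    (hE : ∀ φ ∈ E, 1 ≤ R * (exp (-4 * β) ^ (levelSet N φ.val 0).card *
      (1 + (1 - exp (-4 * β)) * exp (-4 * β) ^ K) ^ (lowSites N φ.val K).card)) :
    prob N β (hw β) E ≤ R := by
  by_cases hs : Summable fun φ : Conf N => weight N β (hw β) φ.val
  · have hZ : 0 ≤ Z N β (hw β) := tsum_nonneg fun φ => (weight_pos N _ _ _).le
    refine div_le_of_le_mul₀ hZ hR (Real.tsum_le_of_sum_le (fun φ => ?_) fun T => ?_)
    · split_ifs
      exacts [(weight_pos N _ _ _).le, le_rfl]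
    · rw [← sum_filter]
      refine le_trans ?_ (mul_le_mul_of_nonneg_left
        (sum_weight_mul_le_Z hβ K hs (T.filter (· ∈ E))) hR)
      rw [mul_sum]
      refine sum_le_sum fun φ hφ => ?_
      have := mul_le_mul_of_nonneg_left (hE φ (mem_filter.1 hφ).2)
        (weight_pos N β (hw β) φ.val).le
      linarith
  · rw [prob, Z, tsum_eq_zero_of_not_summable hs, div_zero]
    exact hR

lemma exp_half_le_one_add {q : ℝ} (h0 : 0 ≤ q) (h1 : q ≤ 1) : exp (q / 2) ≤ 1 + q := by
  have h : 1 - q / 2 ≤ exp (-(q / 2)) := by linarith [add_one_le_exp (-(q / 2))]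
  have hpos : 0 < exp (q / 2) := exp_pos _
  have hmul : exp (q / 2) * exp (-(q / 2)) = 1 := by rw [← exp_add]; simp
  have h2 : exp (q / 2) * (1 - q / 2) ≤ 1 := by nlinarith
  have h3 : exp (q / 2) * ((1 - q / 2) * (1 + q)) ≤ 1 + q := by nlinarith
  have h4 : 1 ≤ (1 - q / 2) * (1 + q) := by nlinarith
  nlinarith

/-- The rate of pinned sites below height `K ≤ (6β)⁻¹ log N - m`. -/
lemma rate_le_exp_pow {β : ℝ} (hβ : 0 < β) {N m K : ℕ} (hN : 1 ≤ N)
    (hK : (K : ℝ) ≤ log N / (6 * β) - m) :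
    exp (4 * β * m) * (N : ℝ) ^ (-(2 : ℝ) / 3) ≤ exp (-4 * β) ^ K := by
  have hN' : (0 : ℝ) < N := by exact_mod_cast hN
  rw [rpow_def_of_pos hN', ← exp_add, ← exp_nat_mul]
  refine exp_le_exp.2 ?_
  have h := mul_le_mul_of_nonneg_left hK (by linarith : 0 ≤ 4 * β)
  have h2 : 4 * β * (log N / (6 * β)) = log N * (2 / 3) := by field_simp; ring
  nlinarith

/-- Proposition 1.4: at criticality `h = h_w(β)`, downward fluctuations below
`H_w = ⌊(6β)⁻¹ log N⌋` are unlikely on the event that there are at most `C N^{4/3}` zeros. -/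
theorem downward_fluctuations_at_criticality (β C : ℝ) (N m : ℕ)
    (hβ : 1 ≤ β) (hC : 0 < C) (hN : 1 ≤ N) (hm : 1 ≤ m) :
    prob N β (hw β)
        ({φ : Conf N | ((levelSet N φ.val 0).card : ℝ) ≤ C * (N:ℝ)^((4:ℝ)/3)} ∩
          {φ : Conf N |
            2 * Real.exp (-2*β*(m:ℝ)) * (N:ℝ)^2 ≤
              (((Lam N).filter fun x =>
                  1 ≤ φ.val x ∧ φ.val x ≤ ⌊Real.log (N:ℝ) / (6*β)⌋ - (m:ℤ)).card : ℝ)}) ≤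
      2 * Real.exp (4*β*(N:ℝ) + 4*β*C*(N:ℝ)^((4:ℝ)/3)
          - (1/2) * Real.exp (2*β*(m:ℝ)) * (N:ℝ)^((4:ℝ)/3)) := by
  have hβ0 : 0 < β := by linarith
  set r := exp (-4 * β) with hr
  have hr0 : 0 < r := exp_pos _
  have hr2 : r ≤ 1 / 2 := by
    have h1 : 2 ≤ exp 1 := by linarith [add_one_le_exp (1 : ℝ)]
    have h2 : r ≤ exp (-1) := exp_le_exp.2 (by linarith)
    rw [exp_neg, ← one_div] at h2
    exact h2.trans (one_div_le_one_div_of_le two_pos h1)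
  have hN' : (0 : ℝ) < N := by exact_mod_cast hN
  set L : ℤ := ⌊Real.log (N:ℝ) / (6*β)⌋ - (m:ℤ) with hL
  set G : ℝ := 1 / 2 * exp (2 * β * m) * (N : ℝ) ^ ((4 : ℝ) / 3) with hG
  refine (prob_le_of_entropy_gain hβ0 L.toNat _
    (R := exp (4 * β * C * (N : ℝ) ^ ((4 : ℝ) / 3) - G)) (exp_pos _).le ?_).trans ?_
  · rintro φ ⟨hzero, hlow⟩
    simp only [Set.mem_ofPred_eq] at hzero hlow
    have hpos : 0 < 2 * exp (-2 * β * m) * (N : ℝ) ^ 2 := by positivity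
    obtain ⟨x, hx⟩ := card_pos.1 (by exact_mod_cast hpos.trans_le hlow)
    have hx' := (mem_filter.1 hx).2
    have hLK : ((L.toNat : ℕ) : ℤ) = L := Int.toNat_of_nonneg (by omega)
    have hK : ((L.toNat : ℕ) : ℝ) ≤ log N / (6 * β) - m := by
      have h1 : ((L.toNat : ℕ) : ℝ) = (L : ℝ) := by exact_mod_cast hLK
      rw [h1, hL]
      push_cast
      linarith [Int.floor_le (log (N : ℝ) / (6 * β))]
    set q := (1 - r) * r ^ L.toNat with hq
    have hrK : r ^ L.toNat ≤ 1 := pow_le_one₀ hr0.le (by linarith)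
    have hrK0 : 0 < r ^ L.toNat := by positivity
    have hq0 : 0 ≤ q := mul_nonneg (by linarith) hrK0.le
    have hq1 : q ≤ 1 := by nlinarith
    have hrate := rate_le_exp_pow hβ0 hN hK
    have hS : 2 * exp (-2 * β * m) * (N : ℝ) ^ 2 ≤ ((lowSites N φ.val L.toNat).card : ℝ) := by
      rw [hLK]; exact hlow
    have hpow : exp (-2 * β * m) * (N : ℝ) ^ 2 * (exp (4 * β * m) * (N : ℝ) ^ (-(2 : ℝ) / 3)) =
        2 * G := by
      have e1 : exp (2 * β * m) = exp (-2 * β * m) * exp (4 * β * m) := by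
        rw [← exp_add]; ring_nf
      have e2 : (N : ℝ) ^ ((4 : ℝ) / 3) = (N : ℝ) ^ 2 * (N : ℝ) ^ (-(2 : ℝ) / 3) := by
        rw [← rpow_natCast, ← rpow_add hN']; norm_num
      rw [hG, e1, e2]
      ring
    have hq2 : 1 / 2 * (exp (4 * β * m) * (N : ℝ) ^ (-(2 : ℝ) / 3)) ≤ q := by nlinarith
    have hGS : G ≤ (lowSites N φ.val L.toNat).card * (q / 2) := by
      have h1 := mul_le_mul_of_nonneg_left hq2
        (by positivity : 0 ≤ exp (-2 * β * m) * (N : ℝ) ^ 2)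
      have h2 := mul_le_mul_of_nonneg_right hS hq0
      linarith
    have hent : exp G ≤ (1 + q) ^ (lowSites N φ.val L.toNat).card := by
      refine (exp_le_exp.2 hGS).trans ?_
      rw [exp_nat_mul]
      exact pow_le_pow_left₀ (exp_pos _).le (exp_half_le_one_add hq0 hq1) _
    have hzr : exp (-(4 * β * C * (N : ℝ) ^ ((4 : ℝ) / 3))) ≤
        r ^ (levelSet N φ.val 0).card := by
      rw [hr, ← exp_nat_mul]
      refine exp_le_exp.2 ?_
      nlinarith
    calc (1 : ℝ) = exp (4 * β * C * (N : ℝ) ^ ((4 : ℝ) / 3) - G) *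
          (exp (-(4 * β * C * (N : ℝ) ^ ((4 : ℝ) / 3))) * exp G) := by
          rw [← exp_add, ← exp_add, eq_comm, exp_eq_one_iff]
          ring
      _ ≤ _ := by gcongr
  · have h1 : exp (4 * β * C * (N : ℝ) ^ ((4 : ℝ) / 3) - G) ≤
        exp (4 * β * N + 4 * β * C * (N : ℝ) ^ ((4 : ℝ) / 3) - G) :=
      exp_le_exp.2 (by nlinarith)
    linarith [exp_pos (4 * β * C * (N : ℝ) ^ ((4 : ℝ) / 3) - G)]
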